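/- For every integer m ≥ 1 there exists an uncountable family of functions φ : ℝ → ℝ such that each φ is real-analytic on ℝ, transcendental, satisfies |φ'(x)| < 0.0001 for all x ∈ ℝ, maps every real algebraic number of degree exactly m to a rational number, and for every real algebraic number α of degree exactly m with q = H(α), the denominator of φ(α) (in lowest terms) is at most (2q)^{450·m^5·2^{18m²}·q^{6m}}. -/

import Mathlib

open Polynomial

/-- The primitive minimal polynomial over ℤ of a real number. -/
noncomputable def intMinpoly (α : ℝ) : Polynomial ℤ :=
  (IsLocalization.integerNormalization (nonZeroDivisors ℤ) (minpoly ℚ α)).primPart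

/-- The height of an algebraic number: the maximum of the absolute values of the
coefficients of its primitive minimal polynomial over ℤ. -/
noncomputable def algHeight (α : ℝ) : ℕ :=
  (intMinpoly α).support.sup fun i => ((intMinpoly α).coeff i).natAbs

/-- `α` is a real algebraic number of degree exactly `m`. -/
def DegreeExactly (m : ℕ) (α : ℝ) : Prop :=
  IsAlgebraic ℚ α ∧ (minpoly ℚ α).natDegree = m

/-- `exp^[3](x) = e^(e^(e^x))`. -/
noncomputable def expCube (x : ℝ) : ℝ := Real.exp (Real.exp (Real.exp x))

/-- `ξ` is an `m`-ultra number: there is a sequence `(α_n)_{n ≥ 1}` of pairwise distinct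
real algebraic numbers of degree exactly `m` with
`0 < |ξ - α_n| < (exp^[3](H(α_n)))^{-n}` for all `n ≥ 1`. Here `a k` plays the
role of `α_{k+1}`. -/
def IsMUltra (m : ℕ) (ξ : ℝ) : Prop :=
  ∃ a : ℕ → ℝ, Function.Injective a ∧
    ∀ n : ℕ, DegreeExactly m (a n) ∧ 0 < |ξ - a n| ∧
      |ξ - a n| < (expCube (algHeight (a n)))⁻¹ ^ (n + 1)

/-- A function `f : ℝ → ℝ` is transcendental if the only complex two-variable polynomial
`P` with `P (x, f x) = 0` for all real `x` is the zero polynomial. -/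
def TranscendentalFun (f : ℝ → ℝ) : Prop :=
  ∀ P : MvPolynomial (Fin 2) ℂ,
    (∀ x : ℝ, MvPolynomial.eval ![(x : ℂ), (f x : ℂ)] P = 0) → P = 0

section AlgebraicNumbers

theorem intMinpoly_ne_zero {α : ℝ} (h : IsAlgebraic ℚ α) : intMinpoly α ≠ 0 := by
  have : IsLocalization.integerNormalization (nonZeroDivisors ℤ) (minpoly ℚ α) ≠ 0 :=
    mt IsFractionRing.integerNormalization_eq_zero_iff.mp (minpoly.ne_zero h.isIntegral)
  exact primPart_ne_zero _

theorem aeval_intMinpoly {α : ℝ} (h : IsAlgebraic ℚ α) : aeval α (intMinpoly α) = 0 := by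
  have h0 : IsLocalization.integerNormalization (nonZeroDivisors ℤ) (minpoly ℚ α) ≠ 0 :=
    mt IsFractionRing.integerNormalization_eq_zero_iff.mp (minpoly.ne_zero h.isIntegral)
  exact aeval_primPart_eq_zero h0
    (IsLocalization.integerNormalization_aeval_eq_zero _ _ (minpoly.aeval ℚ α))

theorem natDegree_intMinpoly_le (α : ℝ) :
    (intMinpoly α).natDegree ≤ (minpoly ℚ α).natDegree := by
  rw [intMinpoly, natDegree_primPart]
  exact natDegree_le_natDegree
    (Finset.sup_mono (IsLocalization.integerNormalization_support _ _))

theorem natAbs_coeff_intMinpoly_le (α : ℝ) (i : ℕ) :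
    ((intMinpoly α).coeff i).natAbs ≤ algHeight α := by
  by_cases h : i ∈ (intMinpoly α).support
  · exact Finset.le_sup (f := fun i => ((intMinpoly α).coeff i).natAbs) h
  · simp [notMem_support_iff.mp h]

theorem one_le_algHeight {α : ℝ} (h : IsAlgebraic ℚ α) : 1 ≤ algHeight α := by
  refine le_trans ?_ (natAbs_coeff_intMinpoly_le α (intMinpoly α).natDegree)
  rw [Nat.one_le_iff_ne_zero, Int.natAbs_ne_zero, coeff_natDegree, leadingCoeff_ne_zero]
  exact intMinpoly_ne_zero h

/-- Cauchy's bound for the complex roots of an integer polynomial. -/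
theorem norm_le_of_aeval_eq_zero {p : ℤ[X]} (hp : p ≠ 0) {q : ℕ}
    (hq : ∀ i, (p.coeff i).natAbs ≤ q) {z : ℂ} (hz : aeval z p = 0) : ‖z‖ ≤ q + 1 := by
  have hinj : Function.Injective (algebraMap ℤ ℂ) := (algebraMap ℤ ℂ).injective_int
  have h0 : p.map (algebraMap ℤ ℂ) ≠ 0 := (Polynomial.map_ne_zero_iff hinj).mpr hp
  have h1 : (p.map (algebraMap ℤ ℂ)).IsRoot z := by
    rwa [IsRoot.def, eval_map_algebraMap]
  have h2 := (IsRoot.norm_lt_cauchyBound h0 h1).le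
  have hco : ∀ i, ‖(p.map (algebraMap ℤ ℂ)).coeff i‖₊ = ((p.coeff i).natAbs : NNReal) := by
    intro i
    rw [coeff_map]
    ext
    simp [Nat.cast_natAbs, Int.norm_eq_abs]
  have hlc : 1 ≤ ‖(p.map (algebraMap ℤ ℂ)).leadingCoeff‖₊ := by
    rw [leadingCoeff, hco]
    rw [natDegree_map_eq_of_injective hinj]
    norm_cast
    rw [Nat.one_le_iff_ne_zero, Int.natAbs_ne_zero, coeff_natDegree, leadingCoeff_ne_zero]
    exact hp
  have h3 : (p.map (algebraMap ℤ ℂ)).cauchyBound ≤ q + 1 := by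
    unfold cauchyBound
    gcongr
    refine (div_le_self zero_le hlc).trans (Finset.sup_le fun i _ => ?_)
    rw [hco]
    exact_mod_cast hq i
  exact_mod_cast h2.trans h3

theorem finite_card_le_of_natDegree_le_of_coeff_le (m q : ℕ) :
    ∃ s : Finset ℝ, s.card ≤ (2 * q + 1) ^ (m + 1) * m ∧
      ∀ (p : ℤ[X]) (α : ℝ), p ≠ 0 → p.natDegree ≤ m → (∀ i, (p.coeff i).natAbs ≤ q) →
        aeval α p = 0 → α ∈ s := by
  classical
  let P : (Fin (m + 1) → ℤ) → ℝ[X] := fun f =>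
    ∑ i : Fin (m + 1), C (f i : ℝ) * X ^ (i : ℕ)
  have hdeg : ∀ f, (P f).natDegree ≤ m := fun f =>
    natDegree_sum_le_of_forall_le _ _ fun i _ =>
      (natDegree_C_mul_X_pow_le _ _).trans (Nat.lt_succ_iff.mp i.2)
  refine ⟨(Fintype.piFinset fun _ : Fin (m + 1) => Finset.Icc (-(q : ℤ)) q).biUnion
    fun f => (P f).roots.toFinset, ?_, ?_⟩
  · refine (Finset.card_biUnion_le_card_mul _ _ m fun f _ => ?_).trans ?_
    · exact (Multiset.toFinset_card_le _).trans ((card_roots' _).trans (hdeg f))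
    · gcongr
      rw [Fintype.card_piFinset]
      simp only [Int.card_Icc, Finset.prod_const, Finset.card_univ, Fintype.card_fin]
      gcongr
      omega
  · intro p α hp hm hq hα
    have hP : P (fun i => p.coeff i) = p.map (Int.castRingHom ℝ) := by
      ext n
      simp only [P, finsetSum_coeff, coeff_C_mul, coeff_X_pow, coeff_map]
      by_cases hn : n < m + 1
      · rw [Finset.sum_eq_single (⟨n, hn⟩ : Fin (m + 1))]
        · simp
        · intro b _ hb
          rw [if_neg (fun h => hb (Fin.ext h.symm)), mul_zero]
        · simp
      · rw [coeff_eq_zero_of_natDegree_lt (p := p) (by omega), Finset.sum_eq_zero]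
        · simp
        · intro b _
          rw [if_neg (by have := b.2; omega), mul_zero]
    rw [Finset.mem_biUnion]
    refine ⟨fun i => p.coeff i, ?_, ?_⟩
    · rw [Fintype.mem_piFinset]
      intro i
      have := hq i
      rw [Finset.mem_Icc]
      omega
    · rw [Multiset.mem_toFinset, hP, mem_roots
        ((Polynomial.map_ne_zero_iff (Int.castRingHom ℝ).injective_int).mpr hp),
        IsRoot.def, eval_map]
      exact hα

theorem exists_finset_degreeExactly (m q : ℕ) :
    ∃ s : Finset ℝ, s.card ≤ (2 * q + 1) ^ (m + 1) * m ∧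
      ∀ α, DegreeExactly m α → algHeight α ≤ q → α ∈ s := by
  obtain ⟨s, hs, h⟩ := finite_card_le_of_natDegree_le_of_coeff_le m q
  refine ⟨s, hs, fun α hα hq => h (intMinpoly α) α (intMinpoly_ne_zero hα.1) ?_ ?_
    (aeval_intMinpoly hα.1)⟩
  · exact hα.2 ▸ natDegree_intMinpoly_le α
  · exact fun i => (natAbs_coeff_intMinpoly_le α i).trans hq

theorem abs_le_algHeight_add_one {α : ℝ} (h : IsAlgebraic ℚ α) : |α| ≤ algHeight α + 1 := by
  have := norm_le_of_aeval_eq_zero (z := (α : ℂ)) (intMinpoly_ne_zero h)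
    (natAbs_coeff_intMinpoly_le α) (by
      rw [← Complex.coe_algebraMap, aeval_algebraMap_apply, aeval_intMinpoly h, map_zero])
  simpa using this

/-- Distinct algebraic numbers of degree `m` and height at most `q` are well separated. -/
theorem one_le_mul_abs_sub {m q : ℕ} (hm : 1 ≤ m) {α β : ℝ} (hα : DegreeExactly m α)
    (hβ : DegreeExactly m β) (hαq : algHeight α ≤ q) (hβq : algHeight β ≤ q) (hne : α ≠ β) :
    1 ≤ (4 * (q : ℝ) ^ 3) ^ (m ^ 2) * |α - β| := by
  have hq1 : (1 : ℝ) ≤ q := by exact_mod_cast (one_le_algHeight hα.1).trans hαq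
  let K := IntermediateField.adjoin ℚ {α} ⊔ IntermediateField.adjoin ℚ {β}
  have : FiniteDimensional ℚ (IntermediateField.adjoin ℚ {α}) :=
    IntermediateField.adjoin.finiteDimensional hα.1.isIntegral
  have : FiniteDimensional ℚ (IntermediateField.adjoin ℚ {β}) :=
    IntermediateField.adjoin.finiteDimensional hβ.1.isIntegral
  have hK : FiniteDimensional ℚ K := IntermediateField.finiteDimensional_sup _ _
  have hrank : Module.finrank ℚ K ≤ m ^ 2 := by
    refine (IntermediateField.finrank_sup_le _ _).trans ?_
    rw [IntermediateField.adjoin.finrank hα.1.isIntegral,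
      IntermediateField.adjoin.finrank hβ.1.isIntegral, hα.2, hβ.2, sq]
  let a : K := ⟨α, (le_sup_left : _ ≤ K) (IntermediateField.mem_adjoin_simple_self ℚ α)⟩
  let b : K := ⟨β, (le_sup_right : _ ≤ K) (IntermediateField.mem_adjoin_simple_self ℚ β)⟩
  have aeval_coe : ∀ (p : ℤ[X]) (x : K), aeval (x : ℝ) p = 0 → aeval x p = 0 := by
    intro p x h
    have : aeval (algebraMap K ℝ x) p = 0 := h
    rw [aeval_algebraMap_apply] at this
    exact (map_eq_zero_iff _ (algebraMap K ℝ).injective).mp this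
  have ha0 : aeval a (intMinpoly α) = 0 := aeval_coe _ a (aeval_intMinpoly hα.1)
  have hb0 : aeval b (intMinpoly β) = 0 := aeval_coe _ b (aeval_intMinpoly hβ.1)
  set u := (intMinpoly α).leadingCoeff
  set v := (intMinpoly β).leadingCoeff
  have hu0 : u ≠ 0 := leadingCoeff_ne_zero.mpr (intMinpoly_ne_zero hα.1)
  have hv0 : v ≠ 0 := leadingCoeff_ne_zero.mpr (intMinpoly_ne_zero hβ.1)
  have huq : |(u : ℝ)| ≤ q := by
    rw [← Int.cast_abs, Int.abs_eq_natAbs]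
    exact_mod_cast (natAbs_coeff_intMinpoly_le α _).trans hαq
  have hvq : |(v : ℝ)| ≤ q := by
    rw [← Int.cast_abs, Int.abs_eq_natAbs]
    exact_mod_cast (natAbs_coeff_intMinpoly_le β _).trans hβq
  let γ : K := (u * v : ℤ) * (a - b)
  have hγint : IsIntegral ℤ γ := by
    have h1 := isIntegral_leadingCoeff_smul _ _ ha0
    have h2 := isIntegral_leadingCoeff_smul _ _ hb0
    have : γ = (v : ℤ) • (u • a) - (u : ℤ) • (v • b) := by
      simp only [γ, zsmul_eq_mul]
      push_cast
      ring
    rw [this]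
    exact (h1.smul v).sub (h2.smul u)
  have hab : a - b ≠ 0 := by
    rw [sub_ne_zero]
    exact fun h => hne (congrArg Subtype.val h)
  have hγ0 : γ ≠ 0 := mul_ne_zero (Int.cast_ne_zero.mpr (mul_ne_zero hu0 hv0)) hab
  have hnorm : (1 : ℝ) ≤ ‖algebraMap ℚ ℂ (Algebra.norm ℚ γ)‖ := by
    obtain ⟨z, hz⟩ := IsIntegrallyClosed.isIntegral_iff.mp (Algebra.isIntegral_norm ℚ hγint)
    have hz0 : z ≠ 0 := by
      rintro rfl
      rw [map_zero, eq_comm, Algebra.norm_eq_zero_iff] at hz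
      exact hγ0 hz
    rw [← hz]
    simp only [eq_intCast, map_intCast]
    rw [Complex.norm_intCast]
    exact_mod_cast Int.one_le_abs hz0
  rw [Algebra.norm_eq_prod_embeddings ℚ ℂ γ, norm_prod] at hnorm
  have hbd : ∀ σ : K →ₐ[ℚ] ℂ, ‖σ γ‖ ≤ 4 * (q : ℝ) ^ 3 := by
    intro σ
    have root_bd : ∀ (x : K) (p : ℤ[X]), p ≠ 0 → (∀ i, (p.coeff i).natAbs ≤ q) →
        aeval x p = 0 → ‖σ x‖ ≤ q + 1 := by
      intro x p hp hc hx
      refine norm_le_of_aeval_eq_zero hp hc ?_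
      have := aeval_algHom_apply (σ.restrictScalars ℤ) x p
      rw [hx, map_zero] at this
      exact this
    have h1 := root_bd a _ (intMinpoly_ne_zero hα.1)
      (fun i => (natAbs_coeff_intMinpoly_le α i).trans hαq) ha0
    have h2 := root_bd b _ (intMinpoly_ne_zero hβ.1)
      (fun i => (natAbs_coeff_intMinpoly_le β i).trans hβq) hb0
    have h3 : σ γ = (u : ℂ) * v * (σ a - σ b) := by simp [γ]
    rw [h3, norm_mul, norm_mul, Complex.norm_intCast, Complex.norm_intCast]
    have h4 : ‖σ a - σ b‖ ≤ 4 * q := (norm_sub_le _ _).trans (by linarith)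
    calc |(u : ℝ)| * |(v : ℝ)| * ‖σ a - σ b‖ ≤ q * q * (4 * q) := by gcongr
      _ = 4 * (q : ℝ) ^ 3 := by ring
  let τ : K →ₐ[ℚ] ℂ := (Complex.ofRealAm.restrictScalars ℚ).comp K.val
  classical
  have hτ : ‖τ γ‖ ≤ (q : ℝ) ^ 2 * |α - β| := by
    have h3 : τ γ = (u : ℂ) * v * ((α - β : ℝ) : ℂ) := by
      have hx : ∀ x : K, τ x = ((x : ℝ) : ℂ) := fun _ => rfl
      rw [hx]
      simp [γ, a, b]
    rw [h3, norm_mul, norm_mul, Complex.norm_intCast, Complex.norm_intCast, Complex.norm_real,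
      Real.norm_eq_abs, sq]
    gcongr
  have h4q : (1 : ℝ) ≤ 4 * (q : ℝ) ^ 3 := by nlinarith [one_le_pow₀ hq1 (n := 3)]
  rw [← Finset.mul_prod_erase _ _ (Finset.mem_univ τ)] at hnorm
  have hrest : ∏ σ ∈ Finset.univ.erase τ, ‖σ γ‖ ≤ (4 * (q : ℝ) ^ 3) ^ (m ^ 2 - 1) := by
    refine (Finset.prod_le_prod (fun _ _ => norm_nonneg _) fun σ _ => hbd σ).trans ?_
    rw [Finset.prod_const, Finset.card_erase_of_mem (Finset.mem_univ τ), Finset.card_univ,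
      AlgHom.card]
    exact pow_le_pow_right₀ h4q (by omega)
  calc (1 : ℝ) ≤ ‖τ γ‖ * ∏ σ ∈ Finset.univ.erase τ, ‖σ γ‖ := hnorm
    _ ≤ (4 * (q : ℝ) ^ 3 * |α - β|) * (4 * (q : ℝ) ^ 3) ^ (m ^ 2 - 1) := by
      gcongr
      refine hτ.trans ?_
      gcongr
      nlinarith [sq_nonneg (q : ℝ)]
    _ = (4 * (q : ℝ) ^ 3) ^ (m ^ 2) * |α - β| := by
      obtain ⟨k, hk⟩ := Nat.exists_eq_add_one_of_ne_zero (pow_ne_zero 2 (by omega : m ≠ 0))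
      rw [hk, Nat.add_sub_cancel, pow_succ]
      ring

theorem infinite_degreeExactly {m : ℕ} (hm : 1 ≤ m) : {α | DegreeExactly m α}.Infinite := by
  have key : ∀ p : ℕ, p.Prime → DegreeExactly m ((p : ℝ) ^ ((m : ℝ)⁻¹)) := by
    intro p hp
    have hm0 : m ≠ 0 := by omega
    have hmon : (X ^ m - C (p : ℤ)).Monic := monic_X_pow_sub_C _ hm0
    have hirr : Irreducible (X ^ m - C (p : ℤ)) := by
      have hpi : Prime (p : ℤ) := Nat.prime_iff_prime_int.mp hp
      refine irreducible_of_eisenstein_criterion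
        ((Ideal.span_singleton_prime hpi.ne_zero).mpr hpi) ?_ ?_ ?_ ?_ hmon.isPrimitive
      · rw [hmon.leadingCoeff, Ideal.mem_span_singleton]
        exact hpi.not_dvd_one
      · intro n hn
        rw [degree_X_pow_sub_C (by omega), Nat.cast_lt] at hn
        rw [Ideal.mem_span_singleton, coeff_sub, coeff_X_pow, if_neg hn.ne, coeff_C]
        split_ifs <;> simp
      · rw [degree_X_pow_sub_C (by omega)]
        exact_mod_cast hm
      · rw [Ideal.span_singleton_pow, Ideal.mem_span_singleton]
        simp only [coeff_sub, coeff_X_pow, coeff_C_zero, if_neg hm0.symm, zero_sub, dvd_neg]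
        intro h
        have h1 : (p : ℤ) * p ∣ p * 1 := by simpa [sq] using h
        exact hpi.not_dvd_one (Int.dvd_of_mul_dvd_mul_left hpi.ne_zero h1)
    have hirr' := (hmon.irreducible_iff_irreducible_map_fraction_map (K := ℚ)).mp hirr
    have hroot : aeval ((p : ℝ) ^ ((m : ℝ)⁻¹)) ((X ^ m - C (p : ℤ)).map (algebraMap ℤ ℚ)) = 0 := by
      simp [Real.rpow_inv_natCast_pow (Nat.cast_nonneg p) hm0]
    have hmin := minpoly.eq_of_irreducible_of_monic hirr' hroot (hmon.map _)
    refine ⟨⟨_, hirr'.ne_zero, hroot⟩, ?_⟩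
    rw [← hmin, hmon.natDegree_map, natDegree_X_pow_sub_C]
  refine Set.infinite_of_injOn_mapsTo (s := {p : ℕ | p.Prime})
    (f := fun p : ℕ => (p : ℝ) ^ ((m : ℝ)⁻¹)) ?_ key Nat.infinite_setOfPred_prime
  intro a _ b _ hab
  have hm0 : m ≠ 0 := by omega
  have := congrArg (· ^ m) hab
  simp only [Real.rpow_inv_natCast_pow (Nat.cast_nonneg _) hm0] at this
  exact_mod_cast this

end AlgebraicNumbers

section Enumeration

theorem exists_enumeration_monotone {A : Set ℝ} (hA : A.Infinite) (h : ℝ → ℕ)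
    (hfin : ∀ q, {α | α ∈ A ∧ h α ≤ q}.Finite) :
    ∃ a : ℕ → ℝ, Function.Injective a ∧ Set.range a = A ∧ Monotone (h ∘ a) := by
  have : Infinite A := hA.to_subtype
  let key : A → ℕ ×ₗ ℝ := fun x => toLex (h x, (x : ℝ))
  have hkey : Function.Injective key := fun x y hxy =>
    Subtype.ext (congrArg (fun z => (ofLex z).2) hxy)
  have hle : ∀ x y, key x < key y → h x ≤ h y := fun x y hxy => by
    rcases Prod.Lex.toLex_lt_toLex.mp hxy with h1 | h1
    · exact h1.le
    · exact h1.1.le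
  have hinit : ∀ x, {y | key y < key x}.Finite := fun x => by
    refine Set.Finite.of_finite_image ((hfin (h x)).subset ?_) Subtype.val_injective.injOn
    rintro _ ⟨y, hy, rfl⟩
    exact ⟨y.2, hle y x hy⟩
  let r : A → ℕ := fun x => {y | key y < key x}.ncard
  have hr : ∀ x y, key x < key y → r x < r y := fun x y hxy =>
    Set.ncard_lt_ncard ⟨fun z hz => lt_trans hz hxy, fun hs => lt_irrefl (key x) (show key x < key x from hs hxy)⟩ (hinit y)
  have hrinj : Function.Injective r := fun x y hxy => by
    rcases lt_trichotomy (key x) (key y) with h1 | h1 | h1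
    · exact absurd hxy (hr _ _ h1).ne
    · exact hkey h1
    · exact absurd hxy (hr _ _ h1).ne'
  have : Infinite (Set.range r) := (Set.infinite_range_of_injective hrinj).to_subtype
  classical
  let o := Nat.Subtype.orderIsoOfNat (Set.range r)
  let e : ℕ ≃ A := o.toEquiv.trans (Equiv.ofInjective r hrinj).symm
  have hre : ∀ n, r (e n) = o n := fun n => Equiv.apply_ofInjective_symm hrinj (o n)
  refine ⟨fun n => e n, Subtype.val_injective.comp e.injective, ?_, ?_⟩
  · rw [show (fun n => (e n : ℝ)) = Subtype.val ∘ e from rfl, Set.range_comp,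
      e.surjective.range_eq, Set.image_univ, Subtype.range_coe]
  · refine monotone_nat_of_le_succ fun n => ?_
    refine hle _ _ (lt_of_not_ge fun hge => ?_)
    have h1 : r (e n) < r (e (n + 1)) := by
      rw [hre, hre]
      exact o.strictMono n.lt_succ_self
    rcases hge.lt_or_eq with h2 | h2
    · exact (hr _ _ h2).asymm h1
    · rw [hkey h2] at h1
      exact h1.false

theorem exists_seq_of_forall_initial_values {R : ℕ → (ℕ → ℝ) → ℝ → Prop}
    (hR : ∀ n c c' x, (∀ j < n, c j = c' j) → R n c x → R n c' x)
    (hex : ∀ n c, ∃ x, R n c x) : ∃ c : ℕ → ℝ, ∀ n, R n c (c n) := by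
  choose F hF using hex
  let c : ℕ → ℝ := fun n => Nat.strongRec (motive := fun _ => ℝ)
    (fun n ih => F n fun j => if hj : j < n then ih j hj else 0) n
  have hc : ∀ n, c n = F n fun j => if j < n then c j else 0 := fun n => by
    simp only [c]
    rw [Nat.strongRec_eq]
    simp
  refine ⟨c, fun n => ?_⟩
  rw [hc n]
  refine hR n _ _ _ (fun j hj => ?_) (hF n _)
  simp [hj]

end Enumeration

section Transcendence

/-- A function on `ℝ` attaining infinitely many values infinitely often is transcendental. -/
theorem transcendentalFun_of_infinite_fibers {f : ℝ → ℝ} {s : Set ℝ} (hs : s.Infinite)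
    (hf : ∀ c ∈ s, {x | f x = c}.Infinite) : TranscendentalFun f := by
  intro P hP
  have key : ∀ c ∈ s, ∀ z : ℂ, MvPolynomial.eval ![z, (c : ℂ)] P = 0 := by
    intro c hc z
    let p : ℂ[X] := MvPolynomial.aeval ![X, C (c : ℂ)] P
    have hp : ∀ w : ℂ, p.eval w = MvPolynomial.eval ![w, (c : ℂ)] P := by
      intro w
      have : (aeval w).comp (MvPolynomial.aeval ![X, C (c : ℂ)]) =
          (MvPolynomial.aeval ![w, (c : ℂ)] : MvPolynomial (Fin 2) ℂ →ₐ[ℂ] ℂ) := by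
        ext i
        fin_cases i <;> simp
      have h2 := congrArg (fun g => g P) this
      simpa [MvPolynomial.aeval_eq_eval, coe_aeval_eq_eval] using h2
    have hp0 : p = 0 := by
      refine eq_zero_of_infinite_isRoot p (((hf c hc).image
        Complex.ofReal_injective.injOn).mono ?_)
      rintro _ ⟨x, hx, rfl⟩
      have hx' : f x = c := hx
      rw [Set.mem_ofPred_eq, IsRoot.def, hp, ← hx']
      exact hP x
    rw [← hp, hp0, eval_zero]
  refine MvPolynomial.funext_set ![Set.univ, Complex.ofReal '' s] ?_ ?_
  · intro i
    fin_cases i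
    · exact Set.infinite_univ
    · exact hs.image Complex.ofReal_injective.injOn
  · intro x hx
    obtain ⟨c, hc, hc'⟩ : x 1 ∈ Complex.ofReal '' s := hx 1 (Set.mem_univ _)
    have : x = ![x 0, (c : ℂ)] := by
      ext i
      fin_cases i
      · rfl
      · exact hc'.symm
    rw [this, key c hc, map_zero]

/-- A continuous function uniformly closer to `ε * sin` than `ε` is transcendental. -/
theorem transcendentalFun_of_abs_sub_sin_le {f : ℝ → ℝ} (hf : Continuous f) {ε δ : ℝ}
    (hδ : δ < ε) (h : ∀ x, |f x - ε * Real.sin x| ≤ δ) : TranscendentalFun f := by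
  refine transcendentalFun_of_infinite_fibers (s := Set.Icc (-(ε - δ)) (ε - δ))
    (Set.Icc_infinite (by linarith)) fun c hc => ?_
  have hroot : ∀ n : ℕ, ∃ x, f x = c ∧ x ∈ Set.Icc (-(Real.pi / 2) + n * (2 * Real.pi))
      (Real.pi / 2 + n * (2 * Real.pi)) := by
    intro n
    have h1 := abs_le.mp (h (-(Real.pi / 2) + n * (2 * Real.pi)))
    have h2 := abs_le.mp (h (Real.pi / 2 + n * (2 * Real.pi)))
    rw [Real.sin_add_nat_mul_two_pi] at h1 h2
    simp only [Real.sin_neg, Real.sin_pi_div_two] at h1 h2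
    obtain ⟨x, hx, hxc⟩ := intermediate_value_Icc
      (by linarith [Real.pi_pos] : -(Real.pi / 2) + n * (2 * Real.pi) ≤
        Real.pi / 2 + n * (2 * Real.pi)) hf.continuousOn
      (⟨by linarith [hc.1], by linarith [hc.2]⟩ : c ∈ Set.Icc _ _)
    exact ⟨x, hxc, hx⟩
  choose x hx hxI using hroot
  refine Set.infinite_of_injective_forall_mem (f := x) ?_ hx
  refine (strictMono_nat_of_lt_succ fun n => ?_).injective
  have h1 := (hxI n).2
  have h2 := (hxI (n + 1)).1
  push_cast at h2
  linarith [Real.pi_pos]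

end Transcendence

section Construction

/-- The product of the functions `t ↦ t / (1 + t ^ 2)` translated to the first `n` nodes. -/
noncomputable def nodeProd {F : Type*} [Field F] (a : ℕ → F) (n : ℕ) (x : F) : F :=
  ∏ j ∈ Finset.range n, (x - a j) / (1 + (x - a j) ^ 2)

theorem nodeProd_ofReal (a : ℕ → ℝ) (n : ℕ) (x : ℝ) :
    nodeProd (fun j => (a j : ℂ)) n x = (nodeProd a n x : ℝ) := by
  simp [nodeProd]

theorem nodeProd_apply_node {F : Type*} [Field F] (a : ℕ → F) {j n : ℕ} (h : j < n) :
    nodeProd a n (a j) = 0 :=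
  Finset.prod_eq_zero (Finset.mem_range.mpr h) (by simp)

theorem half_le_norm_of_im {z : ℂ} (h : 1 / 2 ≤ |z.im|) : 1 / 2 ≤ ‖z‖ :=
  h.trans (Complex.abs_im_le_norm z)

theorem one_add_sq_ne_zero_and_norm_div_le {z : ℂ} (hz : |z.im| < 1 / 2) :
    1 + z ^ 2 ≠ 0 ∧ ‖z / (1 + z ^ 2)‖ ≤ 2 := by
  have hz' := abs_lt.mp hz
  have h1 : 1 / 2 ≤ ‖z + Complex.I‖ := half_le_norm_of_im <| by
    rw [Complex.add_im, Complex.I_im]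
    exact le_trans (by linarith) (le_abs_self _)
  have h2 : 1 / 2 ≤ ‖z - Complex.I‖ := half_le_norm_of_im <| by
    rw [Complex.sub_im, Complex.I_im]
    exact le_trans (by linarith) (neg_le_abs _)
  have hfac : 1 + z ^ 2 = (z + Complex.I) * (z - Complex.I) := by
    linear_combination Complex.I_sq
  have hpos : 0 < ‖1 + z ^ 2‖ := by
    rw [hfac, norm_mul]
    positivity
  refine ⟨norm_pos_iff.mp hpos, ?_⟩
  rw [norm_div, div_le_iff₀ hpos, hfac, norm_mul]
  have h3 : 2 * ‖z‖ ≤ ‖z + Complex.I‖ + ‖z - Complex.I‖ := by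
    have : 2 * z = (z + Complex.I) + (z - Complex.I) := by ring
    calc 2 * ‖z‖ = ‖2 * z‖ := by simp
      _ ≤ _ := by
        rw [this]
        exact norm_add_le _ _
  nlinarith

theorem norm_nodeProd_le (a : ℕ → ℝ) (n : ℕ) {z : ℂ} (hz : |z.im| < 1 / 2) :
    ‖nodeProd (fun j => (a j : ℂ)) n z‖ ≤ 2 ^ n := by
  rw [nodeProd, norm_prod]
  refine (Finset.prod_le_prod (fun _ _ => norm_nonneg _) fun j _ =>
    (one_add_sq_ne_zero_and_norm_div_le (z := z - a j) (by simpa using hz)).2).trans_eq ?_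
  simp

theorem differentiableOn_nodeProd (a : ℕ → ℝ) (n : ℕ) :
    DifferentiableOn ℂ (nodeProd (fun j => (a j : ℂ)) n) {z | |z.im| < 1 / 2} := by
  refine DifferentiableOn.fun_finsetProd fun j _ => DifferentiableOn.div (by fun_prop)
    (by fun_prop) fun z hz => ?_
  exact (one_add_sq_ne_zero_and_norm_div_le (z := z - a j) (by simpa using hz)).1

/-- A sufficiently long interval contains a rational number of small denominator that avoids a
given point. -/
theorem exists_coeff_rat_ne {s g δ e : ℝ} {B : ℕ} (h : 1 ≤ δ * (B * |g|)) :
    ∃ c : ℝ, (|c| ≤ δ ∧ s + c * g ≠ e) ∧ ∃ r : ℚ, s + c * g = r ∧ r.den ≤ B := by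
  have hg : g ≠ 0 := by
    rintro rfl
    norm_num at h
  have hB0 : B ≠ 0 := by
    rintro rfl
    norm_num at h
  have hB : (0 : ℝ) < B := by positivity
  have hgpos : 0 < |g| := abs_pos.mpr hg
  have key : ∀ k : ℤ, |(k : ℝ) - s * B| ≤ 1 → (k : ℝ) / B ≠ e →
      ∃ c : ℝ, (|c| ≤ δ ∧ s + c * g ≠ e) ∧ ∃ r : ℚ, s + c * g = r ∧ r.den ≤ B := by
    intro k hk hne
    have hval : s + ((k : ℝ) / B - s) / g * g = (k : ℝ) / B := by
      field_simp
      ring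
    refine ⟨((k : ℝ) / B - s) / g, ⟨?_, by rwa [hval]⟩, (k : ℚ) / (B : ℤ), ?_, ?_⟩
    · have : (k : ℝ) / B - s = (k - s * B) / B := by field_simp
      rw [this, abs_div, abs_div, abs_of_pos hB, div_div, div_le_iff₀ (by positivity)]
      exact hk.trans h
    · rw [hval]
      push_cast
      rfl
    · have := Int.le_of_dvd (by exact_mod_cast hB) (Rat.den_dvd k B)
      exact_mod_cast this
  have hfl := Int.floor_le (s * B)
  have hfl' := Int.lt_floor_add_one (s * B)
  by_cases hc : ((⌊s * B⌋ : ℤ) : ℝ) / B = e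
  · refine key (⌊s * B⌋ + 1) ?_ ?_
    · push_cast
      rw [abs_le]
      constructor <;> linarith
    · rw [← hc]
      push_cast
      rw [Ne, div_left_inj' hB.ne']
      linarith
  · refine key ⌊s * B⌋ ?_ hc
    rw [abs_le]
    constructor <;> linarith

theorem exists_analytic_interpolation (a e : ℕ → ℝ) (B : ℕ → ℕ)
    (hB : ∀ n, 2 ^ (2 * n + 18) ≤ B n * |nodeProd a n (a n)|) :
    ∃ φ : ℝ → ℝ, ((∀ x, AnalyticAt ℝ φ x) ∧ TranscendentalFun φ ∧ (∀ x, |deriv φ x| < 0.0001)) ∧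
      ∀ n, φ (a n) ≠ e n ∧ ∃ r : ℚ, φ (a n) = r ∧ r.den ≤ B n := by
  let ε : ℝ := 1 / 2 ^ 16
  obtain ⟨c, hc⟩ := exists_seq_of_forall_initial_values
    (R := fun n c x => (|x| ≤ 1 / 2 ^ (2 * n + 18) ∧
      ε * Real.sin (a n) + ∑ j ∈ Finset.range n, c j * nodeProd a j (a n)
        + x * nodeProd a n (a n) ≠ e n) ∧
      ∃ r : ℚ, ε * Real.sin (a n) + ∑ j ∈ Finset.range n, c j * nodeProd a j (a n)
        + x * nodeProd a n (a n) = r ∧ r.den ≤ B n)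
    (by
      intro n c c' x hcc' hx
      have hsum : ∑ j ∈ Finset.range n, c j * nodeProd a j (a n) =
          ∑ j ∈ Finset.range n, c' j * nodeProd a j (a n) :=
        Finset.sum_congr rfl fun j hj => by rw [hcc' j (Finset.mem_range.mp hj)]
      rwa [← hsum])
    (by
      intro n c
      refine exists_coeff_rat_ne ?_
      rw [div_mul_eq_mul_div, one_mul, one_le_div (by positivity)]
      exact hB n)
  let U : Set ℂ := {z | |z.im| < 1 / 2}
  have hU : IsOpen U := isOpen_lt (by fun_prop) continuous_const
  let G : ℕ → ℂ → ℂ := fun n z => c n * nodeProd (fun j => (a j : ℂ)) n z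
  let T : ℂ → ℂ := fun z => ∑' n, G n z
  have hsum : HasSum (fun n : ℕ => ε / 4 * (1 / 2 : ℝ) ^ n) (ε / 2) := by
    convert! hasSum_geometric_two.mul_left (ε / 4) using 1
    ring
  have hGle : ∀ n, ∀ z ∈ U, ‖G n z‖ ≤ ε / 4 * (1 / 2 : ℝ) ^ n := by
    intro n z hz
    rw [norm_mul, Complex.norm_real, Real.norm_eq_abs]
    calc |c n| * ‖nodeProd (fun j => (a j : ℂ)) n z‖ ≤ 1 / 2 ^ (2 * n + 18) * 2 ^ n := by
          gcongr
          · exact (hc n).1.1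
          · exact norm_nodeProd_le a n hz
      _ = ε / 4 * (1 / 2 : ℝ) ^ n := by
          simp only [ε]
          rw [pow_add, two_mul, pow_add, one_div_pow]
          field_simp
          norm_num
  have hTdiff : DifferentiableOn ℂ T U :=
    Complex.differentiableOn_tsum_of_summable_norm hsum.summable
      (fun n => (differentiableOn_nodeProd a n).const_mul _) hU hGle
  have hTle : ∀ z ∈ U, ‖T z‖ ≤ ε / 2 := fun z hz =>
    tsum_of_norm_bounded hsum fun n => hGle n z hz
  have hreal : ∀ x : ℝ, (x : ℂ) ∈ U := fun x => by simp [U]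
  let Φ : ℂ → ℂ := fun z => ε * Complex.sin z + T z
  have hΦdiff : DifferentiableOn ℂ Φ U :=
    (Complex.differentiable_sin.differentiableOn.const_mul _).add hTdiff
  let φ : ℝ → ℝ := fun x => (Φ x).re
  have hφ : ∀ x, φ x = ε * Real.sin x + (T x).re := fun x => by
    simp only [φ, Φ, Complex.add_re, ← Complex.ofReal_sin, ← Complex.ofReal_mul,
      Complex.ofReal_re]
  have hanalytic : ∀ x, AnalyticAt ℝ φ x := fun x =>
    (hΦdiff.analyticAt (hU.mem_nhds (hreal x))).re_ofReal
  refine ⟨φ, ⟨hanalytic, ?_, ?_⟩, ?_⟩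
  · refine transcendentalFun_of_abs_sub_sin_le (ε := ε) (δ := ε / 2)
      (continuous_iff_continuousAt.mpr fun x => (hanalytic x).continuousAt)
      (half_lt_self (by positivity)) fun x => ?_
    rw [hφ, add_sub_cancel_left]
    exact (Complex.abs_re_le_norm _).trans (hTle _ (hreal x))
  · intro x
    have hTx : HasDerivAt T (deriv T x) x :=
      (hTdiff.differentiableAt (hU.mem_nhds (hreal x))).hasDerivAt
    have hball : Metric.closedBall (x : ℂ) (1 / 4) ⊆ U := by
      intro z hz
      have h1 := (Complex.abs_im_le_norm (z - x)).trans (mem_closedBall_iff_norm.mp hz)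
      rw [Complex.sub_im, Complex.ofReal_im, sub_zero] at h1
      exact h1.trans_lt (by norm_num)
    have hTd : ‖deriv T x‖ ≤ ε / 2 / (1 / 4) :=
      Complex.norm_deriv_le_of_forall_mem_sphere_norm_le (by norm_num)
        ((hTdiff.mono hball).diffContOnCl_ball subset_rfl)
        fun z hz => hTle z (hball (Metric.sphere_subset_closedBall hz))
    have hd : HasDerivAt φ (ε * Real.cos x + (deriv T x).re) x := by
      have h1 := ((Real.hasDerivAt_sin x).const_mul ε).add hTx.real_of_complex
      exact h1.congr_of_eventuallyEq (Filter.Eventually.of_forall hφ)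
    rw [hd.deriv]
    calc |ε * Real.cos x + (deriv T x).re| ≤ ε * 1 + ε / 2 / (1 / 4) := by
          refine (abs_add_le _ _).trans (add_le_add ?_ ((Complex.abs_re_le_norm _).trans hTd))
          rw [abs_mul, abs_of_pos (by positivity : 0 < ε)]
          gcongr
          exact Real.abs_cos_le_one x
      _ < 0.0001 := by norm_num [ε]
  · intro n
    have hval : φ (a n) = ε * Real.sin (a n) +
        ∑ j ∈ Finset.range n, c j * nodeProd a j (a n) + c n * nodeProd a n (a n) := by
      have hT : T (a n) = ((∑ j ∈ Finset.range (n + 1), c j * nodeProd a j (a n) : ℝ) : ℂ) := by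
        simp only [T]
        rw [tsum_eq_sum (s := Finset.range (n + 1))]
        · simp [G, nodeProd_ofReal]
        · intro j hj
          rw [Finset.mem_range, not_lt] at hj
          simp only [G]
          rw [nodeProd_ofReal, nodeProd_apply_node a hj]
          simp
      rw [hφ, hT, Complex.ofReal_re, Finset.sum_range_succ, add_assoc]
    rw [hval]
    exact ⟨(hc n).1.2, (hc n).2⟩

end Construction

section DenominatorBound

theorem exponent_le {m q n : ℕ} (hm : 1 ≤ m) (hq : 1 ≤ q)
    (hn : n + 1 ≤ (2 * q + 1) ^ (m + 1) * m) :
    2 * n + 18 + (3 * m ^ 2 + 5) * n ≤ 450 * m ^ 5 * 2 ^ (18 * m ^ 2) * q ^ (6 * m) := by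
  have hY : (2 * q + 1) ^ (m + 1) ≤ 2 ^ (18 * m ^ 2) * q ^ (6 * m) := by
    calc (2 * q + 1) ^ (m + 1) ≤ (2 ^ 2 * q) ^ (m + 1) := by
          gcongr
          omega
      _ = 2 ^ (2 * (m + 1)) * q ^ (m + 1) := by rw [mul_pow, pow_mul]
      _ ≤ 2 ^ (18 * m ^ 2) * q ^ (6 * m) :=
          Nat.mul_le_mul (Nat.pow_le_pow_right two_pos (by nlinarith))
            (Nat.pow_le_pow_right hq (by omega))
  have hY1 : 1 ≤ 2 ^ (18 * m ^ 2) * q ^ (6 * m) := Nat.one_le_iff_ne_zero.mpr (by positivity)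
  set Y := 2 ^ (18 * m ^ 2) * q ^ (6 * m)
  have hnY : n ≤ Y * m := by
    have := Nat.mul_le_mul_right m hY
    omega
  have hm2 : 1 ≤ m ^ 2 := Nat.one_le_pow _ _ hm
  have hm3 : 1 ≤ m ^ 3 := Nat.one_le_pow _ _ hm
  calc 2 * n + 18 + (3 * m ^ 2 + 5) * n = (3 * m ^ 2 + 7) * n + 18 * (1 * 1) := by ring
    _ ≤ (3 * m ^ 2 + 7 * m ^ 2) * (Y * m) + 18 * (m ^ 3 * Y) := by gcongr; omega
    _ = 28 * m ^ 3 * Y := by ring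
    _ ≤ 450 * m ^ 5 * Y := by
        gcongr
        · norm_num
        · norm_num
    _ = _ := by simp only [Y]; ring

theorem one_le_mul_abs_factor {m q : ℕ} (hm : 1 ≤ m) {α β : ℝ} (hα : DegreeExactly m α)
    (hβ : DegreeExactly m β) (hαq : algHeight α ≤ q) (hβq : algHeight β ≤ q) (hne : α ≠ β) :
    1 ≤ (2 * (q : ℝ)) ^ (3 * m ^ 2 + 5) * |(α - β) / (1 + (α - β) ^ 2)| := by
  have hq1 : (1 : ℝ) ≤ q := by exact_mod_cast (one_le_algHeight hα.1).trans hαq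
  have hα' : |α| ≤ q + 1 := (abs_le_algHeight_add_one hα.1).trans (by gcongr)
  have hβ' : |β| ≤ q + 1 := (abs_le_algHeight_add_one hβ.1).trans (by gcongr)
  have habs : |α - β| ≤ 4 * q := (abs_sub _ _).trans (by linarith)
  have hsq : 1 + (α - β) ^ 2 ≤ (2 * (q : ℝ)) ^ 5 := by
    have h1 : (α - β) ^ 2 ≤ (4 * (q : ℝ)) ^ 2 := by
      rw [← sq_abs]
      gcongr
    have h2 : (1 : ℝ) ≤ (q : ℝ) ^ 2 := one_le_pow₀ hq1
    have h3 : (q : ℝ) ^ 2 ≤ (q : ℝ) ^ 5 := pow_le_pow_right₀ hq1 (by norm_num)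
    nlinarith
  have hpos : 0 < 1 + (α - β) ^ 2 := by positivity
  rw [abs_div, abs_of_pos hpos, ← mul_div_assoc, one_le_div hpos, pow_add, mul_right_comm]
  refine hsq.trans (le_mul_of_one_le_left (by positivity) ?_)
  refine (one_le_mul_abs_sub hm hα hβ hαq hβq hne).trans ?_
  rw [pow_mul]
  gcongr
  nlinarith [one_le_pow₀ hq1 (n := 3)]

theorem two_pow_le_mul_abs_nodeProd {m : ℕ} (hm : 1 ≤ m) {a : ℕ → ℝ}
    (hinj : Function.Injective a) (hdeg : ∀ n, DegreeExactly m (a n))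
    (hmono : Monotone (algHeight ∘ a)) (n : ℕ) :
    2 ^ (2 * n + 18) ≤ (((2 * algHeight (a n)) ^ (450 * m ^ 5 * 2 ^ (18 * m ^ 2) *
      (algHeight (a n)) ^ (6 * m)) : ℕ) : ℝ) * |nodeProd a n (a n)| := by
  have hq : 1 ≤ algHeight (a n) := one_le_algHeight (hdeg n).1
  have hmono' : ∀ j ≤ n, algHeight (a j) ≤ algHeight (a n) := fun j hj => hmono hj
  set q := algHeight (a n)
  have hq1 : (1 : ℝ) ≤ q := by exact_mod_cast hq
  have hcount : n + 1 ≤ (2 * q + 1) ^ (m + 1) * m := by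
    obtain ⟨s, hs, hmem⟩ := exists_finset_degreeExactly m q
    refine le_trans ?_ hs
    rw [← Finset.card_range (n + 1), ← Finset.card_image_of_injective _ hinj]
    refine Finset.card_le_card fun x hx => ?_
    obtain ⟨j, hj, rfl⟩ := Finset.mem_image.mp hx
    exact hmem _ (hdeg j) (hmono' j (Nat.lt_succ_iff.mp (Finset.mem_range.mp hj)))
  have hprod : 1 ≤ (2 * (q : ℝ)) ^ ((3 * m ^ 2 + 5) * n) * |nodeProd a n (a n)| := by
    have hconst := Finset.prod_const (s := Finset.range n) ((2 * (q : ℝ)) ^ (3 * m ^ 2 + 5))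
    rw [Finset.card_range] at hconst
    rw [nodeProd, Finset.abs_prod, pow_mul, ← hconst, ← Finset.prod_mul_distrib]
    refine Finset.one_le_prod fun j hj => ?_
    have hj' := Finset.mem_range.mp hj
    exact one_le_mul_abs_factor hm (hdeg n) (hdeg j) le_rfl (hmono' j hj'.le)
      (hinj.ne hj'.ne')
  calc (2 : ℝ) ^ (2 * n + 18) ≤ (2 * (q : ℝ)) ^ (2 * n + 18) * 1 := by
        rw [mul_one]
        gcongr
        linarith
    _ ≤ (2 * (q : ℝ)) ^ (2 * n + 18) *
          ((2 * (q : ℝ)) ^ ((3 * m ^ 2 + 5) * n) * |nodeProd a n (a n)|) := by gcongr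
    _ = (2 * (q : ℝ)) ^ (2 * n + 18 + (3 * m ^ 2 + 5) * n) * |nodeProd a n (a n)| := by
        rw [pow_add _ (2 * n + 18), mul_assoc]
    _ ≤ _ := by
        push_cast
        gcongr
        · linarith
        · exact exponent_le hm hq hcount

end DenominatorBound

/-- There exist uncountably many transcendental real-analytic functions `φ : ℝ → ℝ`
with `|φ'| < 0.0001`, mapping every real algebraic number of degree exactly `m` to a
rational whose denominator is at most `(2q)^(450 m^5 2^(18 m²) q^(6m))`, `q = H(α)`. -/
theorem stmt_1 (m : ℕ) (hm : 1 ≤ m) :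
    ∃ S : Set (ℝ → ℝ), ¬ S.Countable ∧ ∀ φ ∈ S,
      (∀ x : ℝ, AnalyticAt ℝ φ x) ∧ TranscendentalFun φ ∧
      (∀ x : ℝ, |deriv φ x| < 0.0001) ∧
      ∀ α : ℝ, DegreeExactly m α → ∃ r : ℚ, φ α = (r : ℝ) ∧
        r.den ≤ (2 * algHeight α) ^ (450 * m ^ 5 * 2 ^ (18 * m ^ 2) * (algHeight α) ^ (6 * m)) := by
  have hfin : ∀ q, {α | α ∈ {α | DegreeExactly m α} ∧ algHeight α ≤ q}.Finite := fun q => by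
    obtain ⟨s, -, hs⟩ := exists_finset_degreeExactly m q
    exact s.finite_toSet.subset fun α hα => hs α hα.1 hα.2
  obtain ⟨a, hinj, hrange, hmono⟩ :=
    exists_enumeration_monotone (infinite_degreeExactly hm) algHeight hfin
  have hdeg : ∀ n, DegreeExactly m (a n) := fun n => hrange.subset (Set.mem_range_self n)
  refine ⟨{φ | (∀ x : ℝ, AnalyticAt ℝ φ x) ∧ TranscendentalFun φ ∧
    (∀ x : ℝ, |deriv φ x| < 0.0001) ∧ ∀ α : ℝ, DegreeExactly m α → ∃ r : ℚ, φ α = (r : ℝ) ∧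
      r.den ≤ (2 * algHeight α) ^ (450 * m ^ 5 * 2 ^ (18 * m ^ 2) * (algHeight α) ^ (6 * m))},
    fun hcount => ?_, fun φ hφ => hφ⟩
  obtain ⟨f, hf⟩ := Set.countable_iff_exists_subset_range.mp hcount
  obtain ⟨φ, ⟨h1, h2, h3⟩, hφ⟩ := exists_analytic_interpolation a (fun n => f n (a n)) _
    (two_pow_le_mul_abs_nodeProd hm hinj hdeg hmono)
  obtain ⟨n, hn⟩ := hf ⟨h1, h2, h3, fun α hα => by
    obtain ⟨n, rfl⟩ := hrange.superset hα
    exact (hφ n).2⟩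
  exact (hφ n).1 (congrFun hn (a n)).symm
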